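/- For integers 1 ≤ k ≤ n, the following identity holds in the multivariate polynomial ring ℤ[x_0,…,x_{k−1}]: Σ_{I ⊆ {1,…,k}} binom(n, ΔI) · ∏_{i ∈ I} x_{i−1} = Σ_{D ∈ nc(k−1)} E(n,D) · (∏_{i ∈ D} x_i) · (∏_{i ∈ {0,…,k−1}, i ∉ D, i+1 ∉ D} (1+x_i)). (Both sides equal the multivariate augmented Chow polynomial of the uniform matroid U_{k,n}.) -/

import Mathlib

open Finset Polynomial

/-- Differences list: `diffList N prev [m₁,…,m_s] = [m₁ - prev, m₂ - m₁, …, N - m_s]`. -/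
def diffList (N : ℕ) : ℕ → List ℕ → List ℕ
  | prev, [] => [N - prev]
  | prev, m :: ms => (m - prev) :: diffList N m ms

/-- The minima of the maximal blocks of consecutive integers of `I`, listed increasingly. -/
def blockMinima (I : Finset ℕ) : List ℕ :=
  (I.filter fun i => i - 1 ∉ I).sort (· ≤ ·)

/-- The multinomial coefficient `binom(n, ΔI)`:
for `I` with block minima `m₁ < … < m_s` this is
`n! / ((m₁-1)! (m₂-m₁)! ⋯ (m_s-m_{s-1})! (n-m_s+1)!)`, and `1` for `I = ∅`. -/
def binomDelta (n : ℕ) (I : Finset ℕ) : ℕ :=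
  n.factorial / ((diffList (n + 1) 1 (blockMinima I)).map Nat.factorial).prod

/-- One-line notation: `oneline n w i = w(i)` for `i ∈ {1,…,n}`, with values in `{1,…,n}`. -/
def oneline (n : ℕ) (w : Equiv.Perm (Fin n)) (i : ℕ) : ℕ :=
  if h : i - 1 < n then (w ⟨i - 1, h⟩ : ℕ) + 1 else 0

/-- The descent set `Des(w) ⊆ {1,…,n-1}` of a permutation `w` of `{1,…,n}`:
positions `i` with `w(i) > w(i+1)`. -/
def descSet (n : ℕ) (w : Equiv.Perm (Fin n)) : Finset ℕ :=
  (Finset.Ico 1 n).filter fun i => oneline n w (i + 1) < oneline n w i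

/-- `E(n, D)`: the number of permutations of `{1,…,n}` with descent set exactly `D`. -/
def eulerianCount (n : ℕ) (D : Finset ℕ) : ℕ :=
  (Finset.univ.filter fun w : Equiv.Perm (Fin n) => descSet n w = D).card

theorem List.countP_le_succ (L : List ℕ) (d : ℕ) :
    L.countP (· ≤ d + 1) = L.countP (· ≤ d) + L.count (d + 1) := by
  induction L with
  | nil => simp
  | cons m L ih =>
    simp only [List.countP_cons, List.count_cons, ih, decide_eq_true_eq, beq_iff_eq]
    split_ifs <;> omega

theorem List.countP_le_mono (L : List ℕ) : Monotone fun d => L.countP (· ≤ d) :=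
  monotone_nat_of_le_succ fun d => by simp [List.countP_le_succ]

/-- For a monotone `f`, every permutation factors uniquely as one that is increasing on the fibers
of `f`, after one that preserves `f`. -/
theorem card_strictMono_on_fibers_mul {n : ℕ} (f : Fin n → ℕ) (hf : Monotone f) :
    #{w : Equiv.Perm (Fin n) | ∀ i j, i < j → f i = f j → w i < w j}
      * Fintype.card {g : Equiv.Perm (Fin n) // f ∘ g = f} = n.factorial := by
  have key : ∀ w : Equiv.Perm (Fin n), (∀ i j, i < j → f i = f j → w i < w j) →
      w = Tuple.sort (f ∘ ⇑w⁻¹) := fun w hw => by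
    rw [Tuple.eq_sort_iff]
    constructor
    · have : (f ∘ ⇑w⁻¹) ∘ ⇑w = f := by ext; simp
      rwa [this]
    · simpa using hw
  have hinv : ∀ g : Equiv.Perm (Fin n), f ∘ g = f → f ∘ ⇑g⁻¹ = f := fun g hg => by
    ext x
    simpa using (congrFun hg (g⁻¹ x)).symm
  rw [← Fintype.card_subtype, ← Fintype.card_prod]
  conv_rhs => rw [← Fintype.card_fin n, ← Fintype.card_perm]
  refine Fintype.card_of_bijective (f := fun p => p.1.1 * p.2.1) ⟨?_, ?_⟩
  · rintro ⟨⟨w, hw⟩, ⟨g, hg⟩⟩ ⟨⟨w', hw'⟩, ⟨g', hg'⟩⟩ h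
    have h : w * g = w' * g' := h
    have hw1 : f ∘ ⇑(w * g)⁻¹ = f ∘ ⇑w⁻¹ := by
      rw [mul_inv_rev, Equiv.Perm.coe_mul, ← Function.comp_assoc, hinv g hg]
    have hw2 : f ∘ ⇑(w' * g')⁻¹ = f ∘ ⇑w'⁻¹ := by
      rw [mul_inv_rev, Equiv.Perm.coe_mul, ← Function.comp_assoc, hinv g' hg']
    have hww : w = w' := by
      rw [key w hw, key w' hw', ← hw1, ← hw2, h]
    subst hww
    have hgg : g = g' := mul_left_cancel h
    subst hgg
    rfl
  · intro v
    set w := Tuple.sort (f ∘ ⇑v⁻¹) with hw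
    have h2 := Tuple.eq_sort_iff.1 hw
    have h3 : f ∘ ⇑(v⁻¹ * w) = f := by
      have := Tuple.unique_monotone (f := f) (σ := v⁻¹ * w) (τ := 1) h2.1 (by simpa using hf)
      simpa using this
    refine ⟨⟨⟨w, fun i j hij hfij => h2.2 i j hij ?_⟩, ⟨w⁻¹ * v, ?_⟩⟩, by simp⟩
    · have hi := congrFun h3 i
      have hj := congrFun h3 j
      simp only [Function.comp_apply, Equiv.Perm.mul_apply] at hi hj ⊢
      rw [hi, hj, hfij]
    · have := hinv _ h3
      simpa using this

theorem prod_factorial_diffList (N : ℕ) (L : List ℕ) (prev : ℕ) (hs : L.Pairwise (· ≤ ·))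
    (hp : ∀ m ∈ L, prev ≤ m) (hN : ∀ m ∈ L, m ≤ N) :
    ((diffList N prev L).map Nat.factorial).prod
      = ∏ c ∈ range (L.length + 1), (#{p ∈ Ico prev N | L.countP (· ≤ p) = c}).factorial := by
  induction L generalizing prev with
  | nil => simp [diffList]
  | cons m L ih =>
    rw [List.pairwise_cons] at hs
    have hpm := hp m (by simp)
    have hmN := hN m (by simp)
    have hzero : ∀ p, p < m → L.countP (· ≤ p) = 0 := fun p hpm => by
      rw [List.countP_eq_zero]
      intro a ha
      have := hs.1 a ha
      simp only [decide_eq_true_eq]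
      omega
    rw [List.length_cons, prod_range_succ', diffList, List.map_cons, List.prod_cons,
      ih m hs.2 hs.1 (fun a ha => hN a (by simp [ha])), mul_comm]
    congr 1
    · refine prod_congr rfl fun c _ => ?_
      congr 2
      ext p
      simp only [mem_filter, mem_Ico, List.countP_cons, decide_eq_true_eq]
      have := hzero p
      split_ifs <;> omega
    · rw [← Nat.card_Ico]
      congr 2
      ext p
      simp only [mem_filter, mem_Ico, List.countP_cons, decide_eq_true_eq]
      have := hzero p
      grind

theorem card_stabilizer_countP (n : ℕ) (L : List ℕ) (hs : L.Pairwise (· ≤ ·))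
    (hp : ∀ m ∈ L, 1 ≤ m) (hN : ∀ m ∈ L, m ≤ n + 1) :
    Fintype.card {g : Equiv.Perm (Fin n) //
        (fun i : Fin n => L.countP (· ≤ (i : ℕ) + 1)) ∘ g = fun i : Fin n => L.countP (· ≤ (i : ℕ) + 1)}
      = ((diffList (n + 1) 1 L).map Nat.factorial).prod := by
  rw [DomMulAct.stabilizer_card', prod_factorial_diffList _ _ _ hs hp hN]
  have hcard : ∀ c, Fintype.card {i : Fin n // L.countP (· ≤ (i : ℕ) + 1) = c}
      = #{p ∈ Ico 1 (n + 1) | L.countP (· ≤ p) = c} := fun c => by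
    rw [Fintype.card_subtype]
    refine card_bij (fun i _ => (i : ℕ) + 1) ?_ ?_ ?_
    · intro i hi
      simp only [mem_filter, mem_univ, true_and, mem_Ico] at hi ⊢
      exact ⟨by omega, hi⟩
    · intro i _ j _ h
      ext
      omega
    · intro p h
      simp only [mem_filter, mem_Ico] at h
      have hp1 : p - 1 + 1 = p := by omega
      exact ⟨⟨p - 1, by omega⟩, by simpa [hp1] using h.2, hp1⟩
  simp_rw [hcard]
  refine prod_subset ?_ ?_
  · intro c hc
    obtain ⟨i, -, rfl⟩ := mem_image.1 hc
    exact mem_range.2 (Nat.lt_succ_of_le List.countP_le_length)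
  · intro c _ hc
    rw [← hcard, Fintype.card_eq_zero_iff.2, Nat.factorial_zero]
    exact ⟨fun ⟨i, hi⟩ => hc (mem_image.2 ⟨i, mem_univ _, hi⟩)⟩

theorem strictMono_on_fibers_iff_descSet {n : ℕ} (L : List ℕ) (w : Equiv.Perm (Fin n)) :
    (∀ i j : Fin n, i < j → L.countP (· ≤ (i : ℕ) + 1) = L.countP (· ≤ (j : ℕ) + 1) → w i < w j)
      ↔ ∀ d ∈ descSet n w, d + 1 ∈ L := by
  constructor
  · intro h d hd
    simp only [descSet, mem_filter, mem_Ico] at hd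
    obtain ⟨⟨h1, h2⟩, h3⟩ := hd
    by_contra hdL
    have hlt := h ⟨d - 1, by omega⟩ ⟨d, h2⟩ (by simp only [Fin.mk_lt_mk]; omega) (by
      simp only [Nat.sub_add_cancel h1]
      rw [List.countP_le_succ, List.count_eq_zero_of_not_mem hdL, add_zero])
    rw [Fin.lt_def] at hlt
    simp only [oneline, Nat.add_sub_cancel, h2, show d - 1 < n by omega, dif_pos] at h3
    omega
  · intro h
    have step : ∀ b (hb : b < n) (a : Fin n), (a : ℕ) < b →
        L.countP (· ≤ (a : ℕ) + 1) = L.countP (· ≤ b + 1) → w a < w ⟨b, hb⟩ := by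
      intro b
      induction b with
      | zero => intro _ a ha; omega
      | succ b ih =>
        intro hb a ha hc
        have h1 : L.countP (· ≤ (a : ℕ) + 1) ≤ L.countP (· ≤ b + 1) :=
          L.countP_le_mono (by omega)
        have h2 := L.countP_le_succ (b + 1)
        have h3 : b + 1 + 1 ∉ L := fun hm => by
          have := List.count_pos_iff.2 hm
          omega
        have h4 : w ⟨b, by omega⟩ < w ⟨b + 1, hb⟩ := by
          by_contra hlt
          have hne : w ⟨b, by omega⟩ ≠ w ⟨b + 1, hb⟩ := fun he => by
            simpa using w.injective he
          refine h3 (h (b + 1) ?_)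
          simp only [descSet, mem_filter, mem_Ico, oneline, Nat.add_sub_cancel, hb,
            show b < n by omega, dif_pos]
          rw [Fin.lt_def] at hlt
          rw [Ne, Fin.ext_iff] at hne
          exact ⟨⟨by omega, trivial⟩, by omega⟩
        rcases Nat.lt_succ_iff_lt_or_eq.1 ha with hab | hab
        · exact (ih (by omega) a hab (by omega)).trans h4
        · have : a = ⟨b, by omega⟩ := Fin.ext hab
          rwa [this]
    exact fun i j hij hc => step j j.2 i hij hc

theorem binomDelta_eq_card {n : ℕ} {I : Finset ℕ} (hI : I ⊆ Icc 1 n) :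
    binomDelta n I
      = #{w : Equiv.Perm (Fin n) | ∀ d ∈ descSet n w, d + 1 ∈ I ∧ d ∉ I} := by
  set L := blockMinima I with hL
  have hmem : ∀ m, m ∈ L ↔ m ∈ I ∧ m - 1 ∉ I := fun m => by
    simp [hL, blockMinima]
  have hbd : ∀ m ∈ L, 1 ≤ m ∧ m ≤ n := fun m hm => mem_Icc.1 (hI ((hmem m).1 hm).1)
  have h := card_strictMono_on_fibers_mul (fun i : Fin n => L.countP (· ≤ (i : ℕ) + 1))
    (fun i j hij => L.countP_le_mono (by simpa using hij))
  rw [card_stabilizer_countP n L (pairwise_sort _ _) (fun m hm => (hbd m hm).1)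
    (fun m hm => (hbd m hm).2.trans n.le_succ)] at h
  simp only [strictMono_on_fibers_iff_descSet, hmem, Nat.add_sub_cancel] at h
  rw [binomDelta, ← hL, ← h, Nat.mul_div_cancel]
  exact Nat.pos_of_ne_zero fun h0 => n.factorial_ne_zero (by rw [← h, h0, mul_zero])

theorem binomDelta_eq_sum_eulerianCount {n k : ℕ} (hkn : k ≤ n) {I : Finset ℕ}
    (hI : I ⊆ Icc 1 k) :
    binomDelta n I = ∑ D ∈ (Icc 1 (k - 1)).powerset.filter (fun D => ∀ i ∈ D, i + 1 ∉ D),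
      if ∀ d ∈ D, d + 1 ∈ I ∧ d ∉ I then eulerianCount n D else 0 := by
  rw [binomDelta_eq_card (hI.trans (Icc_subset_Icc_right hkn)), ← sum_filter,
    card_eq_sum_card_fiberwise (f := descSet n)]
  · refine sum_congr rfl fun D hD => ?_
    rw [eulerianCount, filter_filter]
    congr 1
    ext w
    simp only [mem_filter, mem_univ, true_and, and_iff_right_iff_imp]
    rintro rfl
    exact (mem_filter.1 hD).2
  · intro w hw
    have hw : ∀ d ∈ descSet n w, d + 1 ∈ I ∧ d ∉ I := by simpa using hw
    simp only [coe_filter, Set.mem_ofPred_eq, mem_powerset, mem_filter]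
    refine ⟨⟨fun d hd => ?_, fun d hd hd' => (hw _ hd').2 (hw d hd).1⟩, hw⟩
    have h1 := mem_Icc.1 (hI (hw d hd).1)
    have h2 := (mem_Ico.1 (mem_filter.1 hd).1).1
    exact mem_Icc.2 ⟨h2, by omega⟩

theorem prod_mul_prod_one_add_eq_sum {R : Type*} [CommSemiring R] (x : ℕ → R) {k : ℕ}
    {D : Finset ℕ} (hD : D ⊆ Icc 1 (k - 1)) (hnc : ∀ i ∈ D, i + 1 ∉ D) :
    (∏ i ∈ D, x i) * ∏ i ∈ (range k).filter (fun i => i ∉ D ∧ i + 1 ∉ D), (1 + x i)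
      = ∑ I ∈ (Icc 1 k).powerset,
          if ∀ d ∈ D, d + 1 ∈ I ∧ d ∉ I then ∏ i ∈ I, x (i - 1) else 0 := by
  have hD' : ∀ d ∈ D, 1 ≤ d ∧ d ≤ k - 1 := fun d hd => mem_Icc.1 (hD hd)
  rw [prod_one_add, mul_sum, ← sum_filter]
  refine sum_bij' (fun T _ => (D ∪ T).image (· + 1)) (fun I _ => (I.image (· - 1)) \ D)
    ?_ ?_ ?_ ?_ ?_
  · intro T hT
    simp only [mem_powerset, subset_iff, mem_filter, mem_range] at hT
    simp only [mem_filter, mem_powerset, subset_iff, mem_image, mem_union, mem_Icc]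
    grind
  · intro I hI
    simp only [mem_filter, mem_powerset, subset_iff, mem_Icc] at hI
    simp only [mem_powerset, subset_iff, mem_filter, mem_range, mem_sdiff, mem_image]
    grind
  · intro T hT
    simp only [mem_powerset, subset_iff, mem_filter, mem_range] at hT
    ext a
    simp only [mem_sdiff, mem_image, mem_union]
    grind
  · intro I hI
    simp only [mem_filter, mem_powerset, subset_iff, mem_Icc] at hI
    ext a
    simp only [mem_sdiff, mem_image, mem_union]
    grind
  · intro T hT
    simp only [mem_powerset, subset_iff, mem_filter, mem_range] at hT
    rw [prod_image (by intro a _ b _ h; simpa using h), prod_union]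
    · simp
    · rw [disjoint_right]
      exact fun a ha => (hT ha).2.1

open MvPolynomial in
/-- For `1 ≤ k ≤ n`, in `ℤ[x₀,…,x_{k-1}]`:
`Σ_{I ⊆ {1,…,k}} binom(n, ΔI) ∏_{i ∈ I} x_{i-1}
  = Σ_{D ∈ nc(k-1)} E(n,D) (∏_{i ∈ D} x_i) ∏_{i ∈ {0,…,k-1}, i ∉ D, i+1 ∉ D} (1 + x_i)`. -/
theorem multivariate_augChow_uniform (n k : ℕ) (hk : 1 ≤ k) (hkn : k ≤ n) :
    ∑ I ∈ (Finset.Icc 1 k).powerset,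
      (binomDelta n I : MvPolynomial ℕ ℤ) * ∏ i ∈ I, X (i - 1)
    = ∑ D ∈ (Finset.Icc 1 (k - 1)).powerset.filter (fun D => ∀ i ∈ D, i + 1 ∉ D),
      (eulerianCount n D : MvPolynomial ℕ ℤ) * (∏ i ∈ D, X i)
        * ∏ i ∈ (Finset.range k).filter (fun i => i ∉ D ∧ i + 1 ∉ D),
            (1 + X i) := by
  have hL : ∀ I ∈ (Finset.Icc 1 k).powerset,
      (binomDelta n I : MvPolynomial ℕ ℤ) * ∏ i ∈ I, X (i - 1)
        = ∑ D ∈ (Finset.Icc 1 (k - 1)).powerset.filter (fun D => ∀ i ∈ D, i + 1 ∉ D),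
          (eulerianCount n D : MvPolynomial ℕ ℤ)
            * if ∀ d ∈ D, d + 1 ∈ I ∧ d ∉ I then ∏ i ∈ I, X (i - 1) else 0 := fun I hI => by
    rw [binomDelta_eq_sum_eulerianCount hkn (mem_powerset.1 hI), Nat.cast_sum, sum_mul]
    refine sum_congr rfl fun D _ => ?_
    split_ifs <;> simp
  rw [sum_congr rfl hL, sum_comm]
  refine sum_congr rfl fun D hD => ?_
  rw [mem_filter, mem_powerset] at hD
  rw [mul_assoc, prod_mul_prod_one_add_eq_sum X hD.1 hD.2, mul_sum]
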